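/- Let X be a projective reduced connected curve, Gorenstein at a singular point P, with 𝔅 = End_{O_X}(𝔪_P) and ψ: X* = Spec(𝔅) → X the natural map. A pure dimension one rank 1 sheaf F on X fails to be locally free at P if and only if there exists a pure dimension one rank 1 sheaf G on X* with ψ_*(G) = F; moreover such G, when it exists, is unique. -/

import Mathlib

open IsLocalRing

/-- The socle of `R/(x)`: elements annihilated by the maximal ideal. -/
def socleOfQuot (R : Type*) [CommRing R] [IsLocalRing R] (x : R) :
    Submodule R (R ⧸ Ideal.span {x}) where
  carrier := {y | ∀ a ∈ maximalIdeal R, a • y = 0}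
  add_mem' := by
    intro y z hy hz a ha
    rw [smul_add, hy a ha, hz a ha, add_zero]
  zero_mem' := by
    intro a _
    rw [smul_zero]
  smul_mem' := by
    intro c y hy a ha
    rw [smul_comm, hy a ha, smul_zero]

/-- Gorenstein for a one-dimensional Noetherian local ring: Cohen–Macaulay of type 1. -/
def IsOneDimGorenstein (R : Type*) [CommRing R] [IsLocalRing R] : Prop :=
  ∃ x : R, x ∈ nonZeroDivisors R ∧ x ∈ maximalIdeal R ∧
    ∃ y : R ⧸ Ideal.span {x}, y ≠ 0 ∧ socleOfQuot R x = Submodule.span R {y}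

/-- Lengths are subadditive along a sequence exact in the middle. -/
theorem Module.length_le_add_of_exact {R A B C : Type*} [CommRing R] [AddCommGroup A]
    [AddCommGroup B] [AddCommGroup C] [Module R A] [Module R B] [Module R C]
    (f : A →ₗ[R] B) (g : B →ₗ[R] C) (h : Function.Exact f g) :
    Module.length R B ≤ Module.length R A + Module.length R C := by
  rw [Module.length_eq_add_of_exact (LinearMap.ker g).subtype g.rangeRestrict
    (Submodule.subtype_injective _) g.surjective_rangeRestrict
    (by intro x; simp [Subtype.ext_iff])]
  refine add_le_add ?_ (Module.length_le_of_injective _ (Submodule.subtype_injective _))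
  rw [LinearMap.exact_iff.mp h]
  exact Module.length_le_of_surjective _ f.surjective_rangeRestrict

/-- A domain quotient of a local ring which is not the residue field has infinite length. -/
theorem Module.length_quotient_prime_eq_top {R : Type*} [CommRing R] [IsLocalRing R]
    (p : Ideal R) [p.IsPrime] (hp : p ≠ maximalIdeal R) : Module.length R (R ⧸ p) = ⊤ := by
  by_contra h
  have hlen := Module.length_ne_top_iff.mp h
  have := (isFiniteLength_iff_isNoetherian_isArtinian.mp hlen).2
  have : IsArtinianRing (R ⧸ p) := isArtinian_of_tower R this
  exact hp (eq_maximalIdeal (Ideal.Quotient.maximal_of_isField _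
    (IsArtinianRing.isField_of_isDomain _)))

/-- If the socle of `A` is cyclic, then `Hom(-, A)` does not increase lengths. -/
theorem Module.length_linearMap_le_of_socle_le_span {R : Type*} {A : Type*} [CommRing R]
    [IsLocalRing R] [IsNoetherianRing R] [AddCommGroup A] [Module R A] (v : A)
    (hv : ∀ a ∈ maximalIdeal R, a • v = 0)
    (hsoc : ∀ z : A, (∀ a ∈ maximalIdeal R, a • z = 0) → z ∈ Submodule.span R {v})
    (L : Type*) [AddCommGroup L] [Module R L] [Module.Finite R L] :
    Module.length R (L →ₗ[R] A) ≤ Module.length R L := by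
  induction ‹Module.Finite R L› using
    IsNoetherianRing.induction_on_isQuotientEquivQuotientPrime R with
  | subsingleton N => simp [Module.length_eq_zero]
  | quotient N p e =>
    have := p.2
    by_cases hp : p.1 = maximalIdeal R
    · let q : (R ⧸ p.1) →ₗ[R] A := p.1.liftQ (LinearMap.toSpanSingleton R A v) (by
        intro a ha
        simpa using hv a (hp ▸ ha))
      let ev : (N →ₗ[R] A) →ₗ[R] A := LinearMap.applyₗ (e.symm (Submodule.Quotient.mk 1))
      have hev : Function.Injective ev := by
        rw [injective_iff_map_eq_zero]
        intro f hf
        ext n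
        obtain ⟨n, rfl⟩ := e.symm.surjective n
        obtain ⟨r, rfl⟩ := Submodule.Quotient.mk_surjective _ n
        have : (Submodule.Quotient.mk r : R ⧸ p.1) = r • Submodule.Quotient.mk 1 := by
          rw [← Submodule.Quotient.mk_smul, smul_eq_mul, mul_one]
        rw [this, map_smul, map_smul]
        change r • ev f = 0
        rw [hf, smul_zero]
      have hle : LinearMap.range ev ≤ LinearMap.range q := by
        rintro _ ⟨f, rfl⟩
        obtain ⟨r, hr⟩ := Submodule.mem_span_singleton.mp (hsoc (ev f) (by
          intro a ha
          change a • f (e.symm (Submodule.Quotient.mk 1)) = 0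
          rw [← map_smul, ← map_smul, ← Submodule.Quotient.mk_smul,
            (Submodule.Quotient.mk_eq_zero _).mpr, map_zero, map_zero]
          rw [hp]
          simpa using ha))
        exact ⟨Submodule.Quotient.mk r, hr⟩
      calc Module.length R (N →ₗ[R] A) ≤ Module.length R (LinearMap.range ev) :=
            Module.length_le_of_injective ev.rangeRestrict
              (by simpa [LinearMap.injective_rangeRestrict_iff] using hev)
        _ ≤ Module.length R (LinearMap.range q) :=
            Module.length_le_of_injective _ (Submodule.inclusion_injective hle)
        _ ≤ Module.length R (R ⧸ p.1) :=
            Module.length_le_of_surjective _ q.surjective_rangeRestrict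
        _ = Module.length R N := e.symm.length_eq
    · rw [e.length_eq, Module.length_quotient_prime_eq_top p.1 hp]
      exact le_top
  | exact N₁ N₂ N₃ f g hf hg hfg h₁ h₃ =>
    rw [Module.length_eq_add_of_exact f g hf hg hfg, add_comm]
    exact (Module.length_le_add_of_exact _ _
      (LinearMap.exact_lcomp_of_exact_of_surjective A hfg hg)).trans (add_le_add h₃ h₁)

/-- A finite length quotient of a local ring with cyclic socle is self-injective, in the form:
endomorphisms vanishing on a submodule `S` detect every element outside `S`. -/
theorem exists_linearMap_ne_zero_of_socle_le_span {R : Type*} [CommRing R]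
    [IsLocalRing R] [IsNoetherianRing R] (W : Ideal R) (hW : IsFiniteLength R (R ⧸ W)) (v : R ⧸ W)
    (hv : ∀ a ∈ maximalIdeal R, a • v = 0)
    (hsoc : ∀ z : R ⧸ W, (∀ a ∈ maximalIdeal R, a • z = 0) → z ∈ Submodule.span R {v})
    (S : Submodule R (R ⧸ W)) (u : R ⧸ W) (hu : u ∉ S) :
    ∃ f : (R ⧸ W) →ₗ[R] (R ⧸ W), (∀ s ∈ S, f s = 0) ∧ f u ≠ 0 := by
  by_contra! hcon
  have := (isFiniteLength_iff_isNoetherian_isArtinian.mp hW).2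
  have h₁ := Module.length_le_of_injective (Algebra.lmul R (R ⧸ W)).toLinearMap
    Algebra.lmul_injective
  have h₂ := Module.length_le_add_of_exact _ _ (LinearMap.exact_lcomp_of_exact_of_surjective
    (R ⧸ W) (LinearMap.exact_subtype_mkQ S) S.mkQ_surjective)
  have h₃ := Module.length_linearMap_le_of_socle_le_span v hv hsoc S
  let T : Submodule R ((R ⧸ W) ⧸ S) := Submodule.span R {S.mkQ u}
  have hT : T ≠ ⊥ := by simpa [T] using hu
  have hsurj : Function.Surjective (LinearMap.lcomp R (R ⧸ W) T.mkQ) := fun g ↦ by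
    refine (LinearMap.exact_lcomp_of_exact_of_surjective (R ⧸ W)
      (LinearMap.exact_subtype_mkQ T) T.mkQ_surjective g).mp ?_
    ext ⟨t, ht⟩
    obtain ⟨c, rfl⟩ := Submodule.mem_span_singleton.mp ht
    have := hcon (g ∘ₗ S.mkQ) (fun s hs ↦ by simp [(Submodule.Quotient.mk_eq_zero S).mpr hs])
    simpa using congr(c • $this)
  have h₄ := Module.length_le_of_surjective _ hsurj
  have h₅ := Module.length_linearMap_le_of_socle_le_span v hv hsoc (((R ⧸ W) ⧸ S) ⧸ T)
  have h₆ := Submodule.length_quotient_lt T hT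
  have h₇ := Module.length_eq_add_of_exact _ _ S.subtype_injective S.mkQ_surjective
    (LinearMap.exact_subtype_mkQ S)
  refine (h₁.trans h₂).not_gt ?_
  rw [h₇, add_comm]
  exact ENat.add_lt_add_of_le_of_lt (ne_top_of_le_ne_top Module.length_ne_top h₃) h₃ (h₄.trans h₅ |>.trans_lt h₆)

theorem IsOneDimGorenstein.exists_socle_generator {R : Type*} [CommRing R] [IsLocalRing R]
    (h : IsOneDimGorenstein R) :
    ∃ x v : R, x ∈ nonZeroDivisors R ∧ x ∈ maximalIdeal R ∧ ¬ x ∣ v ∧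
      (∀ a ∈ maximalIdeal R, x ∣ a * v) ∧
      ∀ r, (∀ a ∈ maximalIdeal R, x ∣ a * r) → ∃ t, x ∣ r - t * v := by
  obtain ⟨x, hx, hxm, y, hy, hsoc⟩ := h
  obtain ⟨v, rfl⟩ := Ideal.Quotient.mk_surjective y
  have key : ∀ r, Ideal.Quotient.mk (Ideal.span {x}) r ∈ socleOfQuot R x ↔
      ∀ a ∈ maximalIdeal R, x ∣ a * r := fun r ↦ by
    refine forall₂_congr fun a _ ↦ ?_
    rw [← Ideal.mem_span_singleton, ← Ideal.Quotient.eq_zero_iff_mem]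
    rfl
  refine ⟨x, v, hx, hxm, ?_, ?_, fun r hr ↦ ?_⟩
  · rwa [← Ideal.mem_span_singleton, ← Ideal.Quotient.eq_zero_iff_mem]
  · rw [← key, hsoc]
    exact Submodule.mem_span_singleton_self _
  · rw [← key, hsoc] at hr
    obtain ⟨t, ht⟩ := Submodule.mem_span_singleton.mp hr
    refine ⟨t, ?_⟩
    rw [← Ideal.mem_span_singleton, ← Ideal.Quotient.eq_zero_iff_mem, map_sub, ← ht, sub_eq_zero]
    rfl

/-- Ideals containing a suitable regular element `x * y` are determined by their annihilators
modulo `x * y`. -/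
theorem exists_mul_dvd_and_not_dvd {R : Type*} [CommRing R] [IsNoetherianRing R] [IsLocalRing R]
    [Ring.KrullDimLE 1 R] {x v : R} (hx : x ∈ nonZeroDivisors R) (hxm : x ∈ maximalIdeal R)
    (hv : ∀ a ∈ maximalIdeal R, x ∣ a * v)
    (hsoc : ∀ r, (∀ a ∈ maximalIdeal R, x ∣ a * r) → ∃ t, x ∣ r - t * v)
    {y : R} (hy : y ∈ nonZeroDivisors R) (K : Ideal R) (hK : x * y ∈ K) {u : R} (hu : u ∉ K) :
    ∃ r, (∀ k ∈ K, x * y ∣ r * k) ∧ ¬ x * y ∣ r * u := by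
  have hdvd : ∀ r, Ideal.Quotient.mk (Ideal.span {x * y}) r = 0 ↔ x * y ∣ r := fun r ↦ by
    rw [← Ideal.mem_span_singleton, ← Ideal.Quotient.eq_zero_iff_mem]
  have hsmul : ∀ a r, a • Ideal.Quotient.mk (Ideal.span {x * y}) r =
    Ideal.Quotient.mk (Ideal.span {x * y}) (a * r) := fun a r ↦ rfl
  obtain ⟨f, hf, hfu⟩ := exists_linearMap_ne_zero_of_socle_le_span (Ideal.span {x * y})
    (isFiniteLength_quotient_span_singleton R (mul_mem hx hy))
    (Ideal.Quotient.mk _ (y * v)) (fun a ha ↦ by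
      rw [hsmul, hdvd, mul_left_comm, mul_comm x]
      exact mul_dvd_mul_left y (hv a ha)) (fun z hz ↦ by
      obtain ⟨z, rfl⟩ := Ideal.Quotient.mk_surjective z
      simp only [hsmul, hdvd] at hz
      obtain ⟨s, hs⟩ := hz x hxm
      obtain rfl : z = y * s := by
        rw [mul_assoc] at hs
        exact (mul_cancel_left_mem_nonZeroDivisors hx).mp hs
      obtain ⟨t, ht⟩ := hsoc s (fun a ha ↦ by
        have := hz a ha
        rw [mul_left_comm, mul_comm x] at this
        obtain ⟨d, hd⟩ := this
        exact ⟨d, (mul_cancel_left_mem_nonZeroDivisors hy).mp (by rw [hd, mul_assoc])⟩)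
      refine Submodule.mem_span_singleton.mpr ⟨t, ?_⟩
      rw [hsmul, eq_comm, ← sub_eq_zero, ← map_sub, hdvd]
      convert mul_dvd_mul_left y ht using 1 <;> ring)
    (Submodule.map (Ideal.span {x * y}).mkQ K) (Ideal.Quotient.mk _ u) (by
      rintro ⟨k, hk, hku⟩
      have : Ideal.Quotient.mk (Ideal.span {x * y}) (k - u) = 0 := by
        rw [map_sub, sub_eq_zero]; exact hku
      rw [hdvd] at this
      exact hu (by simpa using K.sub_mem hk (K.mem_of_dvd this hK)))
  obtain ⟨r, hr⟩ := Ideal.Quotient.mk_surjective (f 1)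
  have hfr : ∀ k, f (Ideal.Quotient.mk _ k) = Ideal.Quotient.mk _ (r * k) := fun k ↦ by
    rw [mul_comm r, ← hsmul, hr, ← map_smul, ← map_one (Ideal.Quotient.mk _), hsmul, mul_one]
  refine ⟨r, fun k hk ↦ ?_, ?_⟩
  · rw [← hdvd, ← hfr]
    exact hf _ ⟨k, hk, rfl⟩
  · rwa [← hdvd, ← hfr]

/-- In a reduced Noetherian ring, the sum of an ideal and its annihilator contains a regular
element. -/
theorem Ideal.exists_mem_nonZeroDivisors_add_annihilator {R : Type*} [CommRing R]
    [IsNoetherianRing R] [IsReduced R] (I : Ideal R) :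
    ∃ i ∈ I, ∃ j, (∀ a ∈ I, j * a = 0) ∧ i + j ∈ nonZeroDivisors R := by
  by_contra! hcon
  obtain ⟨-, r, hr, hr0⟩ := SetLike.lt_iff_le_and_exists.mp <|
    Ideal.bot_lt_annihilator_of_disjoint_nonZeroDivisors (A := R)
      (I := I ⊔ Submodule.annihilator I) (Set.disjoint_left.mpr fun z hz hz' ↦ by
        obtain ⟨i, hi, j, hj, rfl⟩ := Submodule.mem_sup.mp hz
        exact hcon i hi j (fun a ha ↦ Submodule.mem_annihilator.mp hj a ha) hz')
  have hr' := fun a ha ↦ Submodule.mem_annihilator.mp hr a ha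
  refine hr0 (pow_eq_zero_iff two_ne_zero |>.mp (pow_two r ▸ hr' r ?_))
  exact Ideal.mem_sup_right (Submodule.mem_annihilator.mpr fun a ha ↦
    hr' a (Ideal.mem_sup_left ha))

/-- Elements of `R` act on `Module.End R I` through evaluation. -/
theorem Module.End.smul_eq_algebraMap_apply {R : Type*} [CommRing R] {I : Ideal R}
    (φ : Module.End R I) (x : I) :
    (x : R) • φ = algebraMap R (Module.End R I) (φ x : R) := by
  ext s
  have : (x : R) • s = (s : R) • x := Subtype.ext (mul_comm _ _)
  simp only [LinearMap.smul_apply, Module.algebraMap_end_apply]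
  rw [← map_smul, this, map_smul]
  exact mul_comm _ _

theorem Module.End.apply_mul_comm {R : Type*} [CommRing R] {I : Ideal R}
    (φ : Module.End R I) (x y : I) : (x : R) * φ y = y * φ x := by
  have := congr((($(smul_eq_algebraMap_apply φ x)) y : R))
  simpa [mul_comm] using this

theorem LinearMap.exists_eq_mul_of_forall_dvd {R M : Type*} [CommRing R] [AddCommGroup M]
    [Module R M] {w : R} (hw : w ∈ nonZeroDivisors R) (f : M →ₗ[R] R) (hf : ∀ m, w ∣ f m) :
    ∃ g : M →ₗ[R] R, ∀ m, f m = w * g m := by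
  choose g hg using hf
  refine ⟨⟨⟨g, fun a b ↦ ?_⟩, fun c a ↦ ?_⟩, hg⟩ <;>
    refine (mul_cancel_left_mem_nonZeroDivisors hw).mp ?_
  · rw [← hg, map_add, hg, hg, mul_add]
  · rw [← hg, map_smul, hg, smul_eq_mul, smul_eq_mul, RingHom.id_apply, mul_left_comm]

/-- A module isomorphic to an ideal is free as soon as a linear form takes a unit value. -/
theorem Module.Free.of_isUnit_apply {R M : Type*} [CommRing R] [AddCommGroup M] [Module R M]
    (f g : M →ₗ[R] R) (hf : Function.Injective f) (z : M) (hz : IsUnit (g z)) :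
    Module.Free R M := by
  have hcomm : ∀ m n, f m * g n = f n * g m := fun m n ↦ by
    have : f m • n = f n • m := hf (by simp [mul_comm])
    simpa using congr(g $this)
  refine Module.Free.of_equiv (LinearEquiv.ofBijective g ⟨?_, fun r ↦ ?_⟩).symm
  · rw [injective_iff_map_eq_zero]
    intro m hm
    have := hcomm m z
    rw [hm, mul_zero, hz.mul_left_eq_zero] at this
    exact hf (by rw [this, map_zero])
  · obtain ⟨u, hu⟩ := hz
    exact ⟨(r * ↑u⁻¹) • z, by simp [← hu]⟩

/-- Endomorphisms of the maximal ideal of a Gorenstein local ring preserve every submodule on which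
no linear form takes a unit value. -/
theorem IsOneDimGorenstein.apply_mem_range {R M : Type*} [CommRing R] [IsNoetherianRing R]
    [IsLocalRing R] [IsReduced R] [Ring.KrullDimLE 1 R] (h : IsOneDimGorenstein R)
    [AddCommGroup M] [Module R M] (ι : M →ₗ[R] maximalIdeal R)
    (hno : ∀ (g : M →ₗ[R] R) (z : M), ¬ IsUnit (g z))
    (φ : Module.End R (maximalIdeal R)) (z : M) : φ (ι z) ∈ LinearMap.range ι := by
  obtain ⟨x, v, hx, hxm, -, hv, hsoc⟩ := h.exists_socle_generator
  let κ : M →ₗ[R] R := (maximalIdeal R).subtype ∘ₗ ι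
  let I : Ideal R := LinearMap.range κ
  obtain ⟨i, hi, j, hj, hy⟩ := I.exists_mem_nonZeroDivisors_add_annihilator
  have hK : x * (i + j) ∈ I ⊔ Submodule.annihilator I := Ideal.mul_mem_left _ _
    (add_mem (Ideal.mem_sup_left hi)
      (Ideal.mem_sup_right (Submodule.mem_annihilator.mpr fun a ha ↦ hj a ha)))
  have hmem : (φ (ι z) : R) ∈ I ⊔ Submodule.annihilator I := by
    by_contra hu
    obtain ⟨r, hr, hru⟩ := exists_mul_dvd_and_not_dvd hx hxm hv hsoc hy _ hK hu
    obtain ⟨g, hg⟩ := LinearMap.exists_eq_mul_of_forall_dvd (mul_mem hx hy) (r • κ)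
      (fun m ↦ hr _ (Ideal.mem_sup_left ⟨m, rfl⟩))
    have hgz : r • ι z = (x * (i + j)) • (⟨g z, hno g z⟩ : maximalIdeal R) := Subtype.ext (hg z)
    have := congr((φ $hgz : R))
    rw [map_smul, map_smul] at this
    exact hru ⟨_, this⟩
  obtain ⟨b, hb, d, hd, hbd⟩ := Submodule.mem_sup.mp hmem
  have hd' := fun a ha ↦ Submodule.mem_annihilator.mp hd a ha
  have hdz : d • ι z = 0 := Subtype.ext (hd' (κ z) ⟨z, rfl⟩)
  have hd0 : d * (φ (ι z) : R) = 0 := by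
    have := congr((φ $hdz : R))
    rwa [map_smul, map_zero] at this
  rw [← hbd, mul_add, show d * b = 0 from hd' b hb, zero_add, ← pow_two,
    pow_eq_zero_iff two_ne_zero] at hd0
  rw [hd0, add_zero] at hbd
  obtain ⟨m, rfl⟩ := hb
  exact ⟨m, Subtype.ext hbd⟩

/-- A torsion-free module of rank at most one over a reduced Noetherian ring embeds in any ideal
containing a regular element. -/
theorem Module.exists_injective_linearMap_ideal {R M : Type*} [CommRing R] [IsNoetherianRing R]
    [IsReduced R] [AddCommGroup M] [Module R M]
    (htf : ∀ c : R, c ∈ nonZeroDivisors R → ∀ x : M, c • x = 0 → x = 0)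
    {x₀ : M} {c : R} (hc : c ∈ nonZeroDivisors R) (hx₀ : ∀ y : M, c • y ∈ Submodule.span R {x₀})
    (J : Ideal R) {x : R} (hx : x ∈ nonZeroDivisors R) (hxJ : x ∈ J) :
    ∃ ι : M →ₗ[R] J, Function.Injective ι := by
  let I : Ideal R := LinearMap.ker (LinearMap.toSpanSingleton R M x₀)
  obtain ⟨i, hi, j, hj, hij⟩ := I.exists_mem_nonZeroDivisors_add_annihilator
  replace hi : i • x₀ = 0 := hi
  replace hj : ∀ r, r • x₀ = 0 → j * r = 0 := fun r hr ↦ hj r hr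
  choose r hr using fun y ↦ Submodule.mem_span_singleton.mp (hx₀ y)
  let ι : M →ₗ[R] J :=
    { toFun y := ⟨j * r y * x, J.mul_mem_left _ hxJ⟩
      map_add' a b := Subtype.ext <| by
        have := hj (r (a + b) - (r a + r b)) (by
          rw [sub_smul, add_smul, hr, hr, hr, smul_add, sub_self])
        change j * r (a + b) * x = j * r a * x + j * r b * x
        linear_combination x * this
      map_smul' s a := Subtype.ext <| by
        have := hj (r (s • a) - s * r a) (by
          rw [sub_smul, mul_smul, hr, hr, smul_comm, sub_self])
        change j * r (s • a) * x = s * (j * r a * x)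
        linear_combination x * this }
  refine ⟨ι, (injective_iff_map_eq_zero _).mpr fun y hy ↦ htf c hc y ?_⟩
  have hy' : j * r y * x = 0 := congr(($hy : R))
  rw [mul_right_mem_nonZeroDivisors_eq_zero_iff hx] at hy'
  rw [← hr]
  refine htf _ hij _ ?_
  rw [smul_smul, add_mul, hy', add_zero, mul_comm, mul_smul, hi, smul_zero]

/-- An endomorphism algebra acting on `M` through a faithful invariant embedding of `M`. -/
theorem Module.End.nonempty_algHom_of_apply_mem_range {R M N : Type*} [CommRing R]
    [AddCommGroup M] [Module R M] [AddCommGroup N] [Module R N] (ι : M →ₗ[R] N)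
    (hι : Function.Injective ι) (h : ∀ (φ : Module.End R N) (z : M), φ (ι z) ∈ LinearMap.range ι) :
    Nonempty (Module.End R N →ₐ[R] Module.End R M) := by
  choose F hF using h
  let G (φ : Module.End R N) : Module.End R M :=
    { toFun := F φ
      map_add' a b := hι (by simp [hF])
      map_smul' s a := hι (by simp [hF]) }
  have hG : ∀ φ z, ι (G φ z) = φ (ι z) := hF
  exact ⟨AlgHom.ofLinearMap
    { toFun := G
      map_add' _ _ := LinearMap.ext fun _ ↦ hι (by simp [hG])
      map_smul' _ _ := LinearMap.ext fun _ ↦ hι (by simp [hG]) }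
    (LinearMap.ext fun _ ↦ hι (by simp [hG]))
    (fun _ _ ↦ LinearMap.ext fun _ ↦ hι (by simp [hG]))⟩

theorem Module.End.smul_algHom_apply {R M : Type*} [CommRing R] [AddCommGroup M] [Module R M]
    {I : Ideal R} (Φ : Module.End R I →ₐ[R] Module.End R M) (φ : Module.End R I) (x : I) (m : M) :
    (x : R) • Φ φ m = (φ x : R) • m := by
  have := congr(Φ $(smul_eq_algebraMap_apply φ x) m)
  simpa using this

/-- The maximal ideal of a singular one-dimensional Gorenstein local ring has an endomorphism which
is not a multiplication by a ring element. -/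
theorem IsOneDimGorenstein.exists_end_not_dvd {R : Type*} [CommRing R] [IsLocalRing R]
    (h : IsOneDimGorenstein R) (hsing : ∀ x : R, maximalIdeal R ≠ Ideal.span {x}) :
    ∃ (x : maximalIdeal R) (φ : Module.End R (maximalIdeal R)),
      (x : R) ∈ nonZeroDivisors R ∧ ¬ (x : R) ∣ φ x := by
  obtain ⟨x, v, hx, hxm, hxv, hv, -⟩ := h.exists_socle_generator
  obtain ⟨q, hq⟩ := LinearMap.exists_eq_mul_of_forall_dvd hx (v • (maximalIdeal R).subtype)
    (fun m ↦ by simpa [mul_comm] using hv m m.2)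
  replace hq : ∀ s : maximalIdeal R, v * s = x * q s := hq
  have hqm : ∀ s, q s ∈ maximalIdeal R := fun s hs ↦ by
    obtain ⟨e, he⟩ := hs.exists_right_inv
    have hreg : v ∈ nonZeroDivisors R := by
      have : v * s ∈ nonZeroDivisors R := hq s ▸ mul_mem hx hs.mem_nonZeroDivisors
      exact (mul_mem_nonZeroDivisors.mp this).1
    refine hsing s (le_antisymm (fun t ht ↦ ?_) ?_)
    · rw [Ideal.mem_span_singleton]
      refine ⟨e * q ⟨t, ht⟩, (mul_cancel_left_mem_nonZeroDivisors hreg).mp ?_⟩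
      have := hq ⟨t, ht⟩
      linear_combination this - e * q ⟨t, ht⟩ * hq s - x * q ⟨t, ht⟩ * he
    · rw [Ideal.span_singleton_le_iff_mem]
      exact s.2
  refine ⟨⟨x, hxm⟩, q.codRestrict (maximalIdeal R) hqm, hx, ?_⟩
  have : v = q ⟨x, hxm⟩ := (mul_cancel_left_mem_nonZeroDivisors hx).mp
    (by rw [← hq ⟨x, hxm⟩, mul_comm])
  simpa [← this] using hxv

/-- Local form of: let `X` be a projective reduced connected curve, Gorenstein at a singular
point `P`, `𝔅 = End_{O_X}(𝔪_P)` and `ψ : X* = Spec 𝔅 → X`.  A pure dimension one rank 1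
sheaf `F` on `X` fails to be locally free at `P` iff there is a (necessarily unique) pure
dimension one rank 1 sheaf `G` on `X*` with `ψ_*(G) = F`.  Locally: `R = O_{X,P}` is a reduced
Noetherian local Gorenstein ring of dimension 1 with non-principal maximal ideal `m`
(`P` singular); `M = F_P` is a nonzero finitely generated torsion-free `R`-module of rank 1
(there are `x ∈ M` and a nonzerodivisor `c` with `c·M ⊆ R·x`).  The existence of `G` is
equivalent to `M` carrying a `𝔅 = End_R(m)`-module structure extending the `R`-module
structure, i.e. an `R`-algebra map `End_R(m) → End_R(M)`; such a structure exists iff `M` is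
not free, and it is unique. -/
theorem not_locally_free_iff_module_over_endomorphisms
    (R M : Type*) [CommRing R] [IsNoetherianRing R] [IsLocalRing R] [IsReduced R]
    (hdim : ringKrullDim R = 1)
    (hGor : IsOneDimGorenstein R)
    (hsing : ∀ x : R, maximalIdeal R ≠ Ideal.span {x})
    [AddCommGroup M] [Module R M] [Module.Finite R M] [Nontrivial M]
    (htf : ∀ c : R, c ∈ nonZeroDivisors R → ∀ x : M, c • x = 0 → x = 0)
    (hrk1 : ∃ (x : M) (c : R), c ∈ nonZeroDivisors R ∧
      ∀ y : M, c • y ∈ Submodule.span R {x}) :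
    (¬ Module.Free R M ↔
      Nonempty ((Module.End R ↥(maximalIdeal R)) →ₐ[R] Module.End R M)) ∧
    Subsingleton ((Module.End R ↥(maximalIdeal R)) →ₐ[R] Module.End R M) := by
  obtain ⟨x, -, hx, hxm, -⟩ := hGor.exists_socle_generator
  have : Ring.KrullDimLE 1 R := Ring.krullDimLE_iff.mpr hdim.le
  refine ⟨⟨fun hM ↦ ?_, fun ⟨Φ⟩ hM ↦ ?_⟩, ⟨fun Φ Ψ ↦ ?_⟩⟩
  · obtain ⟨x₀, c, hc, hx₀⟩ := hrk1
    obtain ⟨ι, hι⟩ := Module.exists_injective_linearMap_ideal htf hc hx₀ (maximalIdeal R) hx hxm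
    exact Module.End.nonempty_algHom_of_apply_mem_range ι hι
      (hGor.apply_mem_range ι fun g z hz ↦ hM (Module.Free.of_isUnit_apply
        ((maximalIdeal R).subtype ∘ₗ ι) g (Subtype.val_injective.comp hι) z hz))
  · obtain ⟨a, φ, -, hφ⟩ := hGor.exists_end_not_dvd hsing
    let b := Module.Free.chooseBasis R M
    obtain ⟨i⟩ := b.index_nonempty
    have := congr(b.coord i $(Module.End.smul_algHom_apply Φ φ a (b i)))
    exact hφ ⟨b.coord i (Φ φ (b i)), by simpa using this.symm⟩
  · ext φ m
    rw [← sub_eq_zero]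
    refine htf x hx _ ?_
    rw [smul_sub, sub_eq_zero]
    exact (Module.End.smul_algHom_apply Φ φ ⟨x, hxm⟩ m).trans
      (Module.End.smul_algHom_apply Ψ φ ⟨x, hxm⟩ m).symm
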